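/- arXiv:1907.05138 — 2 statements merged into one kernel-verified Lean document; each statement's English description precedes it below -/
import Mathlib

section
/- Consider the random directed multigraph model on N nodes with offspring PGF μ, and for 1 ≤ k ≤ N let q_k be the probability that the out-component of node 0 has exactly k nodes. For every M with 1 ≤ M ≤ N, if μ((M-1)/(N-1)) > 0, then 1 = ∑_{k=1}^{M} c_{k,M} · q_k, where c_{k,M} = [μ((M-1)/(N-1))]^{-k} · ∏_{j=1}^{k-1} (M-j)/(N-j). -/
open scoped Classical

/-- The weight (probability) of a realization `g` of the random directed multigraph on
`N` nodes: independently for each node `u`, its out-degree `ℓ` is drawn from the pmf `p`,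
and then `ℓ` out-neighbors are drawn independently uniformly from the `N - 1` nodes
other than `u` (with replacement).  A realization records for each node the list of
recipients of its out-edges. -/
noncomputable def graphWeight (N : ℕ) (p : ℕ → ℝ) (g : Fin N → List (Fin N)) : ℝ :=
  ∏ u : Fin N,
    if ∀ v ∈ g u, v ≠ u then
      p (g u).length * (1 / ((N : ℝ) - 1)) ^ (g u).length
    else 0

/-- Probability of an event in the random directed multigraph model. -/
noncomputable def graphProb (N : ℕ) (p : ℕ → ℝ) (E : Set (Fin N → List (Fin N))) : ℝ :=
  ∑' g : Fin N → List (Fin N), Set.indicator E (graphWeight N p) g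

/-- The out-component of node `0`: the set of nodes reachable from node `0`
(including node `0` itself) following directed edges. -/
def outComp (N : ℕ) (hN : 0 < N) (g : Fin N → List (Fin N)) : Set (Fin N) :=
  {v | Relation.ReflTransGen (fun a b => b ∈ g a) ⟨0, hN⟩ v}

/-- `qProb N hN p k` is the probability that the out-component of node `0` has exactly
`k` nodes. -/
noncomputable def qProb (N : ℕ) (hN : 0 < N) (p : ℕ → ℝ) (k : ℕ) : ℝ :=
  graphProb N p {g | (outComp N hN g).ncard = k}

open MeasureTheory ProbabilityTheory

instance fsListMS (N : ℕ) : MeasurableSpace (List (Fin N)) := ⊤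

instance fsListDMS (N : ℕ) : DiscreteMeasurableSpace (List (Fin N)) := ⟨fun _ => trivial⟩

noncomputable def fsW (N : ℕ) (p : ℕ → ℝ) (u : Fin N) (l : List (Fin N)) : ℝ :=
  if ∀ v ∈ l, v ≠ u then p l.length * (1 / ((N : ℝ) - 1)) ^ l.length else 0

theorem fsW_nonneg (N : ℕ) (hN : 2 ≤ N) (p : ℕ → ℝ) (hp0 : ∀ ℓ, 0 ≤ p ℓ) (u : Fin N)
    (l : List (Fin N)) : 0 ≤ fsW N p u l := by
  unfold fsW
  have : (2 : ℝ) ≤ N := by exact_mod_cast hN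
  have h2 : 0 ≤ 1 / ((N : ℝ) - 1) := by apply div_nonneg <;> linarith
  split_ifs
  · exact mul_nonneg (hp0 _) (pow_nonneg h2 _)
  · exact le_rfl

theorem fs_tsum (N : ℕ) (hN : 2 ≤ N) (p : ℕ → ℝ) (hp0 : ∀ ℓ, 0 ≤ p ℓ) (hs : Summable p)
    (T : Finset (Fin N)) (u : Fin N) (hu : u ∈ T) :
    ∑' l, Set.indicator {l : List (Fin N) | ∀ x ∈ l, x ∈ T}
      (fun l => ENNReal.ofReal (fsW N p u l)) l =
    ENNReal.ofReal (∑' ℓ, p ℓ * (((T.card : ℝ) - 1) / ((N : ℝ) - 1)) ^ ℓ) := by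
  have hN' : (2 : ℝ) ≤ N := by exact_mod_cast hN
  have hT1 : (1 : ℝ) ≤ T.card := by exact_mod_cast Finset.card_pos.mpr ⟨u, hu⟩
  have hTN : (T.card : ℝ) ≤ N := by
    have := Finset.card_le_univ T
    rw [Fintype.card_fin] at this
    exact_mod_cast this
  have hx0 : 0 ≤ ((T.card : ℝ) - 1) / ((N : ℝ) - 1) := by
    apply div_nonneg <;> linarith
  have hx1 : ((T.card : ℝ) - 1) / ((N : ℝ) - 1) ≤ 1 := by
    rw [div_le_one (by linarith)]; linarith
  rw [ENNReal.ofReal_tsum_of_nonneg (fun n => mul_nonneg (hp0 n) (pow_nonneg hx0 n))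
    (Summable.of_nonneg_of_le (fun n => mul_nonneg (hp0 n) (pow_nonneg hx0 n))
      (fun n => mul_le_of_le_one_right (hp0 n) (pow_le_one₀ hx0 hx1)) hs)]
  rw [← (List.equivSigmaTuple (α := Fin N)).symm.tsum_eq, ENNReal.tsum_sigma']
  congr 1
  ext n
  rw [tsum_fintype]
  have key : ∀ f : Fin n → Fin N,
      Set.indicator {l : List (Fin N) | ∀ x ∈ l, x ∈ T}
      (fun l => ENNReal.ofReal (fsW N p u l)) (List.equivSigmaTuple.symm ⟨n, f⟩) =
      if f ∈ Fintype.piFinset (fun _ : Fin n => T.erase u) then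
        ENNReal.ofReal (p n * (1 / ((N : ℝ) - 1)) ^ n) else 0 := by
    intro f
    have e : List.equivSigmaTuple.symm ⟨n, f⟩ = List.ofFn f := rfl
    rw [e]
    unfold fsW
    simp only [Set.indicator_apply, Set.mem_ofPred_eq, List.length_ofFn, Fintype.mem_piFinset,
      Finset.mem_erase, List.forall_mem_ofFn_iff]
    by_cases h1 : ∀ i, f i ∈ T
    · by_cases h2 : ∀ i, f i ≠ u
      · rw [if_pos h1, if_pos h2, if_pos (fun i => ⟨h2 i, h1 i⟩)]
      · rw [if_pos h1, if_neg h2, if_neg (fun h => h2 fun i => (h i).1)]; simp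
    · rw [if_neg h1, if_neg (fun h => h1 fun i => (h i).2)]
  rw [Finset.sum_congr rfl (fun f _ => key f), ← Finset.sum_filter, Finset.sum_const]
  have hc : (Finset.univ.filter (fun f => f ∈ Fintype.piFinset (fun _ : Fin n => T.erase u))).card
      = (T.card - 1) ^ n := by
    rw [Finset.filter_mem_eq_inter, Finset.univ_inter, Fintype.card_piFinset]
    simp [Finset.card_erase_of_mem hu]
  rw [hc, nsmul_eq_mul, ← ENNReal.ofReal_natCast, ← ENNReal.ofReal_mul (by positivity)]
  congr 1
  have : 1 ≤ T.card := Finset.card_pos.mpr ⟨u, hu⟩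
  push_cast [this]
  rw [div_pow, div_pow]
  ring

theorem fs_tsum_one (N : ℕ) (hN : 2 ≤ N) (p : ℕ → ℝ) (hp0 : ∀ ℓ, 0 ≤ p ℓ)
    (hpsum : ∑' ℓ, p ℓ = 1) (u : Fin N) :
    ∑' l, ENNReal.ofReal (fsW N p u l) = 1 := by
  have hs : Summable p := by
    by_contra h
    rw [tsum_eq_zero_of_not_summable h] at hpsum
    norm_num at hpsum
  have hN' : (2 : ℝ) ≤ N := by exact_mod_cast hN
  have := fs_tsum N hN p hp0 hs Finset.univ u (Finset.mem_univ _)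
  simp only [Finset.mem_univ, implies_true, Set.ofPred_true, Set.indicator_univ,
    Finset.card_univ, Fintype.card_fin] at this
  rw [this, div_self (by linarith)]
  simp [hpsum]

noncomputable def fsPMF (N : ℕ) (hN : 2 ≤ N) (p : ℕ → ℝ) (hp0 : ∀ ℓ, 0 ≤ p ℓ)
    (hpsum : ∑' ℓ, p ℓ = 1) (u : Fin N) : PMF (List (Fin N)) :=
  ⟨fun l => ENNReal.ofReal (fsW N p u l), by
    rw [← fs_tsum_one N hN p hp0 hpsum u]
    exact ENNReal.summable.hasSum⟩

noncomputable def fsP {N : ℕ} (P : Fin N → PMF (List (Fin N))) :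
    Measure (Fin N → List (Fin N)) := Measure.pi (fun u => (P u).toMeasure)

instance fsP_prob {N : ℕ} (P : Fin N → PMF (List (Fin N))) : IsProbabilityMeasure (fsP P) := by
  unfold fsP; infer_instance

theorem fs_graphProb (N : ℕ) (hN : 2 ≤ N) (p : ℕ → ℝ) (hp0 : ∀ ℓ, 0 ≤ p ℓ)
    (hpsum : ∑' ℓ, p ℓ = 1) (E : Set (Fin N → List (Fin N))) :
    graphProb N p E = (fsP (fsPMF N hN p hp0 hpsum)).real E := by
  rw [Measure.real, ← Measure.tsum_indicator_apply_singleton _ E (Set.to_countable E).measurableSet,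
    ENNReal.tsum_toReal_eq]
  · unfold graphProb
    congr 1
    ext g
    by_cases hg : g ∈ E
    · rw [Set.indicator_of_mem hg, Set.indicator_of_mem hg, fsP, Measure.pi_singleton,
        ENNReal.toReal_prod]
      unfold graphWeight
      refine Finset.prod_congr rfl fun u _ => ?_
      rw [PMF.toMeasure_apply_singleton _ _ (MeasurableSet.of_discrete)]
      exact (ENNReal.toReal_ofReal (fsW_nonneg N hN p hp0 u (g u))).symm
    · simp [hg]
  · intro g
    by_cases hg : g ∈ E
    · rw [Set.indicator_of_mem hg]; exact measure_ne_top _ _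
    · simp [hg]

theorem fs_comp_sub {N : ℕ} (h0 : 0 < N) (g : Fin N → List (Fin N)) (T : Set (Fin N))
    (hT : (⟨0, h0⟩ : Fin N) ∈ T) (hc : ∀ v ∈ T, ∀ x ∈ g v, x ∈ T) : outComp N h0 g ⊆ T := by
  intro v hv
  have hv' : Relation.ReflTransGen (fun a b => b ∈ g a) ⟨0, h0⟩ v := hv
  induction hv' with
  | refl => exact hT
  | tail h1 h2 ih => exact hc _ (ih h1) _ h2

theorem fs_comp_closed {N : ℕ} (h0 : 0 < N) (g : Fin N → List (Fin N)) :
    ∀ v ∈ outComp N h0 g, ∀ x ∈ g v, x ∈ outComp N h0 g :=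
  fun _ hv _ hx => Relation.ReflTransGen.tail hv hx

theorem fs_comp_zero {N : ℕ} (h0 : 0 < N) (g : Fin N → List (Fin N)) :
    (⟨0, h0⟩ : Fin N) ∈ outComp N h0 g := Relation.ReflTransGen.refl

theorem fs_comp_local {N : ℕ} (h0 : 0 < N) (g g' : Fin N → List (Fin N)) (S : Set (Fin N))
    (hg : outComp N h0 g = S) (h : ∀ v ∈ S, g v = g' v) : outComp N h0 g' = S := by
  subst hg
  have hsub : outComp N h0 g' ⊆ outComp N h0 g := by
    apply fs_comp_sub h0 g' _ (fs_comp_zero h0 g)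
    intro v hv x hx
    rw [← h v hv] at hx
    exact fs_comp_closed h0 g v hv x hx
  apply hsub.antisymm
  have : outComp N h0 g ⊆ outComp N h0 g ∩ outComp N h0 g' := by
    apply fs_comp_sub h0 g (outComp N h0 g ∩ outComp N h0 g')
      ⟨fs_comp_zero h0 g, fs_comp_zero h0 g'⟩
    rintro v ⟨hv, hv'⟩ x hx
    refine ⟨fs_comp_closed h0 g v hv x hx, ?_⟩
    rw [h v hv] at hx
    exact fs_comp_closed h0 g' v hv' x hx
  exact fun v hv => (this hv).2

theorem fs_box {N : ℕ} (P : Fin N → PMF (List (Fin N))) (T R : Finset (Fin N))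
    (hRT : R ⊆ T) (a : ℝ)
    (ha : ∀ u ∈ T, (P u).toMeasure.real {l | ∀ x ∈ l, x ∈ T} = a) :
    (fsP P).real {g | ∀ v ∈ R, ∀ x ∈ g v, x ∈ T} = a ^ R.card := by
  have : {g : Fin N → List (Fin N) | ∀ v ∈ R, ∀ x ∈ g v, x ∈ T} =
      Set.univ.pi (fun v => if v ∈ R then {l | ∀ x ∈ l, x ∈ T} else Set.univ) := by
    ext g
    simp only [Set.mem_ofPred_eq, Set.mem_univ_pi]
    refine forall_congr' fun v => ?_
    by_cases hv : v ∈ R <;> simp [hv]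
  rw [this, Measure.real, fsP, Measure.pi_pi, ENNReal.toReal_prod]
  have h2 : ∀ v, ((P v).toMeasure
      (if v ∈ R then {l | ∀ x ∈ l, x ∈ T} else Set.univ)).toReal = if v ∈ R then a else 1 := by
    intro v
    by_cases hv : v ∈ R
    · simp only [hv, if_true]; exact ha v (hRT hv)
    · simp [hv]
  rw [Finset.prod_congr rfl (fun v _ => h2 v), Finset.prod_ite_mem, Finset.univ_inter,
    Finset.prod_const]

theorem fs_indep {N : ℕ} (h0 : 0 < N) (P : Fin N → PMF (List (Fin N))) (S T : Finset (Fin N)) :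
    (fsP P).real ({g | outComp N h0 g = ↑S} ∩ {g | ∀ v ∈ T \ S, ∀ x ∈ g v, x ∈ T}) =
    (fsP P).real {g | outComp N h0 g = ↑S} *
      (fsP P).real {g | ∀ v ∈ T \ S, ∀ x ∈ g v, x ∈ T} := by
  have hi : iIndepFun (fun (i : Fin N) (ω : Fin N → List (Fin N)) => ω i) (fsP P) :=
    iIndepFun_pi (μ := fun u => (P u).toMeasure) (X := fun _ l => l)
      (fun i => aemeasurable_id)
  have h2 := hi.indepFun_finset S (T \ S) Finset.disjoint_sdiff
    (fun i => measurable_pi_apply i)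
  have h3 := h2.measure_inter_preimage_eq_mul
    {h : S → List (Fin N) | outComp N h0 (fun v => if hv : v ∈ S then h ⟨v, hv⟩ else []) = ↑S}
    {h : (T \ S : Finset (Fin N)) → List (Fin N) | ∀ v, ∀ x ∈ h v, x ∈ T}
    (Set.to_countable _).measurableSet (Set.to_countable _).measurableSet
  have e1 : (fun (a : Fin N → List (Fin N)) (i : S) => a i) ⁻¹'
      {h : S → List (Fin N) | outComp N h0 (fun v => if hv : v ∈ S then h ⟨v, hv⟩ else []) = ↑S}
      = {g | outComp N h0 g = ↑S} := by
    ext g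
    simp only [Set.mem_preimage, Set.mem_ofPred_eq]
    constructor <;> intro h <;> refine fs_comp_local h0 _ _ _ h ?_ <;> intro v hv <;>
      simp [Finset.mem_coe.mp hv]
  have e2 : (fun (a : Fin N → List (Fin N)) (i : (T \ S : Finset (Fin N))) => a i) ⁻¹'
      {h : (T \ S : Finset (Fin N)) → List (Fin N) | ∀ v, ∀ x ∈ h v, x ∈ T}
      = {g | ∀ v ∈ T \ S, ∀ x ∈ g v, x ∈ T} := by
    ext g
    simp only [Set.mem_preimage, Set.mem_ofPred_eq, Subtype.forall]
  rw [e1, e2] at h3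
  simp only [Measure.real]
  rw [h3, ENNReal.toReal_mul]

theorem fs_fixedT {N : ℕ} (h0 : 0 < N) (P : Fin N → PMF (List (Fin N))) (T : Finset (Fin N))
    (hT : (⟨0, h0⟩ : Fin N) ∈ T) (a : ℝ)
    (ha : ∀ u ∈ T, (P u).toMeasure.real {l | ∀ x ∈ l, x ∈ T} = a) :
    a ^ T.card = ∑ S ∈ T.powerset,
      (fsP P).real {g | outComp N h0 g = ↑S} * a ^ (T.card - S.card) := by
  rw [← fs_box P T T subset_rfl a ha]
  have hU : {g : Fin N → List (Fin N) | ∀ v ∈ T, ∀ x ∈ g v, x ∈ T} =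
      ⋃ S ∈ T.powerset, ({g | outComp N h0 g = ↑S} ∩
        {g | ∀ v ∈ T \ S, ∀ x ∈ g v, x ∈ T}) := by
    ext g
    simp only [Set.mem_ofPred_eq, Set.mem_iUnion, Set.mem_inter_iff, Finset.mem_powerset,
      exists_prop]
    constructor
    · intro h
      refine ⟨(outComp N h0 g).toFinset, ?_, by simp, fun v hv => h v (Finset.mem_sdiff.mp hv).1⟩
      intro v hv
      exact fs_comp_sub h0 g (T : Set (Fin N)) hT h (by simpa using hv)
    · rintro ⟨S, hS, hgS, h⟩ v hv x hx
      by_cases hvS : v ∈ S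
      · have := fs_comp_closed h0 g v (by rw [hgS]; exact hvS) x hx
        rw [hgS] at this
        exact hS this
      · exact h v (Finset.mem_sdiff.mpr ⟨hv, hvS⟩) x hx
  rw [hU, measureReal_biUnion_finset]
  · refine Finset.sum_congr rfl fun S hS => ?_
    rw [fs_indep, fs_box P T (T \ S) Finset.sdiff_subset a ha,
      Finset.card_sdiff_of_subset (Finset.mem_powerset.mp hS)]
  · intro S _ S' _ hne
    refine Set.disjoint_left.mpr ?_
    rintro g ⟨h1, _⟩ ⟨h2, _⟩
    exact hne (Finset.coe_injective ((Eq.symm h1).trans h2))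
  · intro S _
    exact (Set.to_countable _).measurableSet

theorem fs_count {N : ℕ} (S : Finset (Fin N)) (M : ℕ) (hM : S.card ≤ M) :
    (Finset.univ.filter (fun T : Finset (Fin N) => S ⊆ T ∧ T.card = M)).card =
      (N - S.card).choose (M - S.card) := by
  have : (N - S.card) = (Sᶜ).card := by rw [Finset.card_compl, Fintype.card_fin]
  rw [this, ← Finset.card_powersetCard]
  refine Finset.card_nbij' (fun T => T \ S) (fun R => R ∪ S) ?_ ?_ ?_ ?_
  · intro T hT
    simp only [Finset.coe_filter, Finset.mem_univ, true_and, Set.mem_ofPred_eq] at hT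
    simp only [Finset.mem_coe, Finset.mem_powersetCard]
    refine ⟨fun x hx => by simp_all, ?_⟩
    rw [Finset.card_sdiff_of_subset hT.1, hT.2]
  · intro R hR
    simp only [Finset.mem_coe, Finset.mem_powersetCard] at hR
    simp only [Finset.coe_filter, Finset.mem_univ, true_and, Set.mem_ofPred_eq]
    refine ⟨Finset.subset_union_right, ?_⟩
    rw [Finset.card_union_of_disjoint, hR.2]
    · omega
    · exact Finset.disjoint_left.mpr fun x hx => by simpa using hR.1 hx
  · intro T hT
    simp only [Finset.coe_filter, Finset.mem_univ, true_and, Set.mem_ofPred_eq] at hT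
    exact Finset.sdiff_union_of_subset hT.1
  · intro R hR
    simp only [Finset.mem_coe, Finset.mem_powersetCard] at hR
    ext x
    have := @hR.1 x
    simp only [Finset.mem_compl] at this
    simp only [Finset.mem_sdiff, Finset.mem_union]
    tauto

theorem fs_choose (N M : ℕ) (hMN : M ≤ N) (k : ℕ) (hk : 1 ≤ k) (hkM : k ≤ M) :
    ((N - k).choose (M - k) : ℝ) = (N - 1).choose (M - 1) *
      ∏ j ∈ Finset.Icc 1 (k - 1), (((M : ℝ) - j) / ((N : ℝ) - j)) := by
  induction k, hk using Nat.le_induction with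
  | base => simp
  | succ k hk ih =>
    have ih := ih (by omega)
    obtain ⟨i, rfl⟩ : ∃ i, k = i + 1 := ⟨k - 1, by omega⟩
    simp only [Nat.add_sub_cancel] at ih ⊢
    rw [Finset.prod_Icc_succ_top (by omega), ← mul_assoc, ← ih]
    have h := Nat.add_one_mul_choose_eq (N - (i + 1 + 1)) (M - (i + 1 + 1))
    have e1 : N - (i + 1 + 1) + 1 = N - (i + 1) := by omega
    have e2 : M - (i + 1 + 1) + 1 = M - (i + 1) := by omega
    rw [e1, e2] at h
    have h' : ((N - (i + 1) : ℕ) : ℝ) * ((N - (i + 1 + 1)).choose (M - (i + 1 + 1)) : ℝ) =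
      ((N - (i + 1)).choose (M - (i + 1)) : ℝ) * ((M - (i + 1) : ℕ) : ℝ) := by exact_mod_cast h
    rw [Nat.cast_sub (by omega), Nat.cast_sub (by omega)] at h'
    have hne : (N : ℝ) - ((i + 1 : ℕ) : ℝ) ≠ 0 := by
      have : ((i + 1 : ℕ) : ℝ) < N := by exact_mod_cast (by omega : i + 1 < N)
      linarith
    rw [← mul_div_assoc, eq_div_iff hne, ← h']
    ring

theorem fs_main {N : ℕ} (h0 : 0 < N) (P : Fin N → PMF (List (Fin N))) (M : ℕ) (hM1 : 1 ≤ M)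
    (a : ℝ)
    (ha : ∀ T : Finset (Fin N), T.card = M →
      ∀ u ∈ T, (P u).toMeasure.real {l | ∀ x ∈ l, x ∈ T} = a) :
    ((N - 1).choose (M - 1) : ℝ) * a ^ M = ∑ k ∈ Finset.Icc 1 M,
      ((N - k).choose (M - k) : ℝ) * a ^ (M - k) *
        (fsP P).real {g | (outComp N h0 g).ncard = k} := by
  set z : Fin N := ⟨0, h0⟩ with hz
  set Q : Finset (Fin N) → ℝ := fun S => (fsP P).real {g | outComp N h0 g = ↑S} with hQ
  have hQ0 : ∀ S, z ∉ S → Q S = 0 := by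
    intro S hS
    have : {g | outComp N h0 g = (S : Set (Fin N))} = ∅ := by
      ext g
      simp only [Set.mem_ofPred_eq, Set.mem_empty_iff_false, iff_false]
      intro h
      have h1 := fs_comp_zero h0 g
      rw [h] at h1
      exact hS h1
    simp only [hQ, this, measureReal_empty]
  have hq : ∀ k, (fsP P).real {g | (outComp N h0 g).ncard = k} =
      ∑ S ∈ Finset.univ.filter (fun S : Finset (Fin N) => S.card = k), Q S := by
    intro k
    rw [hQ, ← measureReal_biUnion_finset]
    · congr 1
      ext g
      simp only [Set.mem_ofPred_eq, Set.mem_iUnion, Finset.mem_filter, Finset.mem_univ, true_and,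
        exists_prop]
      constructor
      · intro h
        refine ⟨(outComp N h0 g).toFinset, ?_, by simp⟩
        rw [← h, Set.ncard_eq_toFinset_card']
      · rintro ⟨S, hS, h⟩
        rw [h, Set.ncard_coe_finset, hS]
    · intro S _ S' _ hne
      refine Set.disjoint_left.mpr ?_
      intro g h1 h2
      exact hne (Finset.coe_injective ((Eq.symm h1).trans h2))
    · intro S _
      exact (Set.to_countable _).measurableSet
  set F := Finset.univ.filter (fun T : Finset (Fin N) => {z} ⊆ T ∧ T.card = M) with hF
  have hFc : F.card = (N - 1).choose (M - 1) := by
    have := fs_count ({z} : Finset (Fin N)) M (by simpa using hM1)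
    simpa [hF] using this
  have h1 : ∑ T ∈ F, a ^ M = ∑ T ∈ F, ∑ S ∈ T.powerset, Q S * a ^ (M - S.card) := by
    refine Finset.sum_congr rfl fun T hT => ?_
    simp only [hF, Finset.mem_filter, Finset.mem_univ, true_and, Finset.singleton_subset_iff] at hT
    have := fs_fixedT h0 P T hT.1 a (ha T hT.2)
    rw [hT.2] at this
    exact this
  rw [Finset.sum_const, hFc, nsmul_eq_mul] at h1
  rw [h1]
  have h2 : ∑ T ∈ F, ∑ S ∈ T.powerset, Q S * a ^ (M - S.card) =
      ∑ S ∈ Finset.univ.filter (fun S : Finset (Fin N) => S.card ∈ Finset.Icc 1 M),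
        ∑ T ∈ Finset.univ.filter (fun T : Finset (Fin N) => S ⊆ T ∧ T.card = M),
        Q S * a ^ (M - S.card) := by
    have h3 : ∀ T ∈ F, ∑ S ∈ T.powerset, Q S * a ^ (M - S.card) =
        ∑ S ∈ T.powerset.filter (fun S => z ∈ S), Q S * a ^ (M - S.card) := by
      intro T _
      rw [Finset.sum_filter]
      refine Finset.sum_congr rfl fun S _ => ?_
      by_cases h : z ∈ S
      · simp [h]
      · simp [h, hQ0 S h]
    rw [Finset.sum_congr rfl h3]
    have h4 : ∀ S ∈ Finset.univ.filter (fun S : Finset (Fin N) => S.card ∈ Finset.Icc 1 M),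
        ∑ T ∈ Finset.univ.filter (fun T : Finset (Fin N) => S ⊆ T ∧ T.card = M),
        Q S * a ^ (M - S.card) =
        ∑ T ∈ Finset.univ.filter (fun T : Finset (Fin N) => z ∈ S ∧ S ⊆ T ∧ T.card = M),
        Q S * a ^ (M - S.card) := by
      intro S _
      by_cases h : z ∈ S
      · simp [h]
      · simp [h, hQ0 S h]
    rw [Finset.sum_congr rfl h4]
    refine Finset.sum_comm' ?_
    intro T S
    simp only [hF, Finset.mem_filter, Finset.mem_univ, true_and, Finset.singleton_subset_iff,
      Finset.mem_powerset, Finset.mem_Icc]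
    constructor
    · rintro ⟨⟨h5, h6⟩, h7, h8⟩
      exact ⟨⟨h8, h7, h6⟩, Finset.card_pos.mpr ⟨z, h8⟩, h6 ▸ Finset.card_le_card h7⟩
    · rintro ⟨⟨h8, h7, h6⟩, _⟩
      exact ⟨⟨h7 h8, h6⟩, h7, h8⟩
  rw [h2, ← Finset.sum_fiberwise_of_maps_to (t := Finset.Icc 1 M) (g := Finset.card)
    (fun S hS => (Finset.mem_filter.mp hS).2)]
  refine Finset.sum_congr rfl fun k hk => ?_
  rw [hq, Finset.mul_sum, Finset.filter_filter]
  have hk' := Finset.mem_Icc.mp hk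
  refine Finset.sum_congr ?_ fun S hS => ?_
  · ext S
    simp only [Finset.mem_filter, Finset.mem_univ, true_and]
    constructor
    · exact fun h => h.2
    · rintro rfl
      exact ⟨hk, rfl⟩
  · have hS' : S.card = k := (Finset.mem_filter.mp hS).2
    rw [Finset.sum_const, fs_count S M (by omega), hS', nsmul_eq_mul]
    ring

theorem final_size_triangular_system
    (N : ℕ) (hN : 2 ≤ N) (p : ℕ → ℝ)
    (hp0 : ∀ ℓ, 0 ≤ p ℓ) (hp1 : ∀ ℓ, p ℓ ≤ 1) (hpsum : ∑' ℓ, p ℓ = 1)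
    (μ : ℝ → ℝ) (hμ : ∀ x, μ x = ∑' ℓ, p ℓ * x ^ ℓ)
    (M : ℕ) (hM1 : 1 ≤ M) (hMN : M ≤ N)
    (hpos : 0 < μ (((M : ℝ) - 1) / ((N : ℝ) - 1))) :
    1 = ∑ k ∈ Finset.Icc 1 M,
        ((μ (((M : ℝ) - 1) / ((N : ℝ) - 1))) ^ (-(k : ℤ)) *
          ∏ j ∈ Finset.Icc 1 (k - 1), (((M : ℝ) - j) / ((N : ℝ) - j))) *
        qProb N (by omega) p k := by
  have h0 : 0 < N := by omega
  have hs : Summable p := by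
    by_contra h
    rw [tsum_eq_zero_of_not_summable h] at hpsum
    norm_num at hpsum
  set a := μ (((M : ℝ) - 1) / ((N : ℝ) - 1)) with hadef
  have hmain := fs_main h0 (fsPMF N hN p hp0 hpsum) M hM1 a (by
    intro T hT u hu
    rw [Measure.real, PMF.toMeasure_apply _ MeasurableSet.of_discrete]
    have := fs_tsum N hN p hp0 hs T u hu
    rw [hT, ← hμ, ← hadef] at this
    change (∑' l, Set.indicator {l : List (Fin N) | ∀ x ∈ l, x ∈ T}
      (fun l => ENNReal.ofReal (fsW N p u l)) l).toReal = a
    rw [this, ENNReal.toReal_ofReal hpos.le])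
  have hC : (0 : ℝ) < ((N - 1).choose (M - 1) : ℝ) := by
    exact_mod_cast Nat.choose_pos (by omega)
  have hCa : ((N - 1).choose (M - 1) : ℝ) * a ^ M ≠ 0 := by positivity
  apply mul_left_cancel₀ hCa
  rw [mul_one]
  refine hmain.trans ?_
  rw [Finset.mul_sum]
  refine Finset.sum_congr rfl fun k hk => ?_
  have hk' := Finset.mem_Icc.mp hk
  rw [fs_choose N M hMN k hk'.1 hk'.2, qProb, fs_graphProb N hN p hp0 hpsum]
  have e : a ^ (M - k) = a ^ M * a ^ (-(k : ℤ)) := by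
    rw [zpow_neg, zpow_natCast, pow_sub₀ a hpos.ne' hk'.2]
  rw [e]
  ring
end

section
/- Fix integers N ≥ 1, s with 1 ≤ s ≤ N, and i ≥ 1, and an offspring distribution given by a probability mass function p : ℕ → [0,1] with ∑_j p(j) = 1 and probability generating function μ(x) = ∑_j p(j) x^j. Each of i infected individuals independently draws its number of transmissions from p, and each transmission independently targets an individual chosen uniformly at random from all N individuals (with replacement), of which a fixed set of s are susceptible. Let m be the number of distinct susceptible individuals receiving at least one transmission. Then for every m ≥ 0, the probability that exactly m distinct susceptibles are hit equals ∑_{ℓ=m}^{∞} p_s(m,ℓ) · (s/N)^ℓ · (1/ℓ!) · f^{(ℓ)}((N-s)/N), where f(x) = (μ(x))^i and f^{(ℓ)} denotes its ℓ-th derivative. -/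
lemma aux_cauchy (p : ℕ → ℝ) (hp0 : ∀ j, 0 ≤ p j) (hps : Summable p) (i : ℕ) :
    ∃ c : ℕ → ℝ, (∀ k, 0 ≤ c k) ∧ Summable c ∧
      ∀ x : ℝ, |x| ≤ 1 → (∑' j, p j * x ^ j) ^ i = ∑' k, c k * x ^ k := by
  have key : ∀ c : ℕ → ℝ, (∀ k, 0 ≤ c k) → Summable c → ∀ x : ℝ, |x| ≤ 1 →
      Summable fun k => ‖c k * x ^ k‖ := by
    intro c hc hs x hx
    refine Summable.of_nonneg_of_le (fun _ => norm_nonneg _) (fun k => ?_) hs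
    rw [norm_mul, norm_pow, Real.norm_of_nonneg (hc k), Real.norm_eq_abs]
    exact mul_le_of_le_one_right (hc k) (pow_le_one₀ (abs_nonneg _) hx)
  induction i with
  | zero =>
    refine ⟨fun k => if k = 0 then 1 else 0, fun k => by dsimp; split_ifs <;> norm_num, ?_, ?_⟩
    · exact (hasSum_ite_eq 0 (1:ℝ)).summable
    · intro x hx
      rw [pow_zero, tsum_eq_single 0]
      · simp
      · intro b hb; simp [hb]
  | succ i ih =>
    obtain ⟨c, hc, hs, h⟩ := ih
    refine ⟨fun n => ∑ kl ∈ Finset.HasAntidiagonal.antidiagonal n, c kl.1 * p kl.2, fun k =>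
      Finset.sum_nonneg fun a _ => mul_nonneg (hc _) (hp0 _), ?_, ?_⟩
    · have := summable_norm_sum_mul_antidiagonal_of_summable_norm hs.norm hps.norm
      exact this.of_norm
    · intro x hx
      rw [pow_succ, h x hx, tsum_mul_tsum_eq_tsum_sum_antidiagonal_of_summable_norm
        (key c hc hs x hx) (key p hp0 hps x hx)]
      refine tsum_congr fun n => ?_
      rw [Finset.sum_mul]
      refine Finset.sum_congr rfl fun kl hkl => ?_
      rw [← Finset.HasAntidiagonal.mem_antidiagonal.1 hkl, pow_add]; ring

lemma aux_swap (c : ℕ → ℝ) (hc : ∀ k, 0 ≤ c k) (hs : Summable c) (x y : ℝ) (hx : 0 ≤ x)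
    (hy : |y| ≤ 1 - x) :
    HasSum (fun l : ℕ => (∑' k, c k * (k.choose l) * x ^ (k - l)) * y ^ l)
      (∑' k, c k * (x + y) ^ k) := by
  let F : ℝ → ℕ × ℕ → ℝ := fun y q => c q.1 * (q.1.choose q.2) * x ^ (q.1 - q.2) * y ^ q.2
  have hin : ∀ y k, HasSum (fun l => F y (k, l)) (c k * (x + y) ^ k) := by
    intro y k
    have : c k * (x + y) ^ k = ∑ l ∈ Finset.range (k + 1), F y (k, l) := by
      rw [add_comm x y, add_pow, Finset.mul_sum]
      refine Finset.sum_congr rfl fun l _ => ?_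
      simp only [F]; ring
    rw [this]
    refine hasSum_sum_of_ne_finset_zero fun l hl => ?_
    have : k < l := by simpa using hl
    simp [F, Nat.choose_eq_zero_of_lt this]
  have habs : Summable (F |y|) := by
    rw [summable_prod_of_nonneg]
    · refine ⟨fun k => (hin _ k).summable, ?_⟩
      simp_rw [fun k => (hin |y| k).tsum_eq]
      refine Summable.of_nonneg_of_le (fun k => mul_nonneg (hc k) (by positivity)) (fun k => ?_) hs
      exact mul_le_of_le_one_right (hc k) (pow_le_one₀ (by positivity) (by linarith))
    · intro q
      have := hc q.1
      simp only [F, Pi.zero_apply]; positivity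
  have hsum : Summable (F y) := by
    refine Summable.of_norm (habs.congr fun q => ?_)
    simp only [F, norm_mul, norm_pow, Real.norm_eq_abs, abs_of_nonneg (hc _), Nat.abs_cast,
      abs_of_nonneg hx]
  have hG : Summable (fun q : ℕ × ℕ => F y q.swap) := hsum.prod_symm
  have h1 := hG.hasSum.prod_fiberwise fun l => (hG.prod_factor l).hasSum
  have h2 : ∑' q : ℕ × ℕ, F y q.swap = ∑' k, c k * (x + y) ^ k := by
    refine ((Equiv.prodComm ℕ ℕ).tsum_eq (F y)).trans ?_
    rw [hsum.tsum_prod]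
    exact tsum_congr fun k => (hin y k).tsum_eq
  rw [h2] at h1
  convert h1 using 2 with l
  rw [← tsum_mul_right]; rfl

lemma aux_deriv (c : ℕ → ℝ) (hc : ∀ k, 0 ≤ c k) (hs : Summable c) (x : ℝ) (hx : 0 ≤ x)
    (hx1 : x < 1) (f : ℝ → ℝ) (hf : ∀ x : ℝ, |x| ≤ 1 → f x = ∑' k, c k * x ^ k) (l : ℕ) :
    1 / (l.factorial : ℝ) * iteratedDeriv l f x = ∑' k, c k * (k.choose l) * x ^ (k - l) := by
  have h : HasFPowerSeriesAt f (FormalMultilinearSeries.ofScalars ℝ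
      (fun l : ℕ => ∑' k, c k * (k.choose l) * x ^ (k - l))) x := by
    rw [hasFPowerSeriesAt_iff]
    have : Metric.ball (0:ℝ) (1 - x) ∈ nhds (0:ℝ) := Metric.ball_mem_nhds _ (by linarith)
    filter_upwards [this] with y hy
    have hy : |y| < 1 - x := by simpa using hy
    rw [hf (x + y)]
    · simpa [FormalMultilinearSeries.coeff_ofScalars, mul_comm] using aux_swap c hc hs x y hx hy.le
    · refine (abs_add_le _ _).trans ?_
      rw [abs_of_nonneg hx]; linarith
  have h2 := h.eq_formalMultilinearSeries h.analyticAt.hasFPowerSeriesAt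
  have h3 := congrArg (fun q => FormalMultilinearSeries.coeff q l) h2
  simp only [FormalMultilinearSeries.coeff_ofScalars] at h3
  rw [h3]; ring

lemma aux_prod {α : Type*} (w : α → ℝ) (hw : ∀ a, 0 ≤ w a) (hs : Summable w) (i : ℕ) :
    HasSum (fun g : Fin i → α => ∏ u, w (g u)) ((∑' a, w a) ^ i) := by
  induction i with
  | zero =>
    simp
  | succ i ih =>
    rw [pow_succ']
    have hnn : 0 ≤ (fun g : Fin i → α => ∏ u, w (g u)) :=
      Pi.le_def.2 fun g => Finset.prod_nonneg fun _ _ => hw _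
    have hS : Summable fun q : α × (Fin i → α) => w q.1 * ∏ u, w (q.2 u) :=
      Summable.mul_of_nonneg (f := w) (g := fun g : Fin i → α => ∏ u, w (g u))
        hs ih.summable (Pi.le_def.2 hw) hnn
    have := hs.hasSum.mul ih hS
    have h2 : (fun g : Fin (i+1) → α => ∏ u, w (g u)) ∘ (Fin.consEquiv (fun _ : Fin (i+1) => α))
        = fun q : α × (Fin i → α) => w q.1 * ∏ u, w (q.2 u) := by
      funext q
      simp [Fin.consEquiv, Fin.prod_univ_succ]
    refine ((Fin.consEquiv (fun _ : Fin (i+1) => α)).hasSum_iff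
      (f := fun g : Fin (i+1) → α => ∏ u, w (g u))).1 ?_
    rw [h2]
    exact this

lemma aux_list (N : ℕ) (hN : 1 ≤ N) (p : ℕ → ℝ) (hp0 : ∀ j, 0 ≤ p j) (hps : Summable p)
    (A : Finset (Fin N)) :
    HasSum (fun l : List (Fin N) => if ∀ v ∈ l, v ∈ A then
      p l.length * (1 / (N : ℝ)) ^ l.length else 0)
      (∑' j, p j * ((A.card : ℝ) / N) ^ j) := by
  have hN' : (0:ℝ) < N := by exact_mod_cast hN
  rw [← List.equivSigmaTuple.symm.hasSum_iff]
  have hin : ∀ n, HasSum (fun f : Fin n → Fin N => if ∀ a, f a ∈ A then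
      p n * (1 / (N : ℝ)) ^ n else 0) (p n * ((A.card : ℝ) / N) ^ n) := by
    intro n
    have h := hasSum_fintype (fun f : Fin n → Fin N => if ∀ a, f a ∈ A then
      p n * (1 / (N : ℝ)) ^ n else 0)
    convert h using 1
    rw [← Finset.sum_filter, Finset.sum_const]
    have : (Finset.univ.filter fun f : Fin n → Fin N => ∀ a, f a ∈ A)
        = Fintype.piFinset fun _ => A := by ext; simp
    rw [this, Fintype.card_piFinset]
    simp [div_eq_mul_inv, mul_pow]; ring
  have hcard : (A.card : ℝ) / N ≤ 1 := by
    rw [div_le_one hN']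
    exact_mod_cast (Finset.card_le_univ A).trans (by simp)
  have hS : Summable fun n => p n * ((A.card : ℝ) / N) ^ n :=
    Summable.of_nonneg_of_le (fun n => mul_nonneg (hp0 n) (by positivity))
      (fun n => mul_le_of_le_one_right (hp0 n) (pow_le_one₀ (by positivity) hcard)) hps
  let G : (Σ n, Fin n → Fin N) → ℝ := fun q => if ∀ a, q.2 a ∈ A then
      p q.1 * (1 / (N : ℝ)) ^ q.1 else 0
  have hG : Summable G := by
    rw [summable_sigma_of_nonneg]
    · exact ⟨fun n => (hin n).summable, by simpa only [G, fun n => (hin n).tsum_eq] using hS⟩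
    · intro q
      have := hp0 q.1
      simp only [G]; split_ifs <;> positivity
  have h1 := hG.hasSum
  rw [hG.tsum_sigma] at h1
  simp only [G, fun n => (hin n).tsum_eq] at h1
  convert h1 using 2 with q
  simp [List.equivSigmaTuple, List.mem_ofFn]

lemma aux_mobius {α : Type*} [DecidableEq α] (A B : Finset α → ℝ)
    (h : ∀ T : Finset α, ∑ U ∈ T.powerset, A U = ∑ U ∈ T.powerset, B U) (T : Finset α) : A T = B T := by
  induction T using Finset.strongInduction with
  | H T ih =>
    have h1 := h T
    rw [← Finset.insert_erase (Finset.mem_powerset_self T), Finset.sum_insert (by simp),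
      Finset.sum_insert (by simp)] at h1
    have : ∑ U ∈ T.powerset.erase T, A U = ∑ U ∈ T.powerset.erase T, B U := by
      refine Finset.sum_congr rfl fun U hU => ih U ?_
      rw [Finset.mem_erase, Finset.mem_powerset] at hU
      exact Finset.ssubset_iff_subset_ne.2 ⟨hU.2, hU.1⟩
    linarith


open scoped Classical

/-- `distinctProb s ℓ m` is the probability that `ℓ` independent draws, each uniform on
a set of `s` elements (with replacement), yield exactly `m` distinct values. -/
noncomputable def distinctProb (s ℓ m : ℕ) : ℝ :=
  ((Finset.univ.filter (fun f : Fin ℓ → Fin s =>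
      (Finset.univ.image f).card = m)).card : ℝ) / (s : ℝ) ^ ℓ

/-- The weight (probability) of a realization `g` of transmissions: each of `i` infected
individuals independently draws its number of transmissions from the pmf `p`, and each
transmission independently targets a uniformly random individual among all `N`
individuals (with replacement).  A realization records for each infected individual the
list of targets of its transmissions. -/
noncomputable def transWeight (N i : ℕ) (p : ℕ → ℝ) (g : Fin i → List (Fin N)) : ℝ :=
  ∏ u : Fin i, p (g u).length * (1 / (N : ℝ)) ^ (g u).length

/-- Probability of an event in the transmission model. -/
noncomputable def transProb (N i : ℕ) (p : ℕ → ℝ) (E : Set (Fin i → List (Fin N))) : ℝ :=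
  ∑' g : Fin i → List (Fin N), Set.indicator E (transWeight N i p) g

theorem new_generation_size_probability
    (N s i : ℕ) (hN : 1 ≤ N) (hs1 : 1 ≤ s) (hsN : s ≤ N) (hi : 1 ≤ i)
    (p : ℕ → ℝ) (hp0 : ∀ j, 0 ≤ p j) (hp1 : ∀ j, p j ≤ 1) (hpsum : ∑' j, p j = 1)
    (μ : ℝ → ℝ) (hμ : ∀ x, μ x = ∑' j, p j * x ^ j)
    (S : Finset (Fin N)) (hS : S.card = s)
    (m : ℕ) :
    transProb N i p {g | (S.filter (fun v => ∃ u, v ∈ g u)).card = m} =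
      ∑' ℓ : ℕ,
        if m ≤ ℓ then
          distinctProb s ℓ m * ((s : ℝ) / (N : ℝ)) ^ ℓ * (1 / (ℓ.factorial : ℝ)) *
            iteratedDeriv ℓ (fun x => (μ x) ^ i) (((N : ℝ) - s) / (N : ℝ))
        else 0 := by
  have hps : Summable p := by
    by_contra hcon
    rw [tsum_eq_zero_of_not_summable hcon] at hpsum
    norm_num at hpsum
  have hN' : (0:ℝ) < N := by exact_mod_cast hN
  have hs' : (0:ℝ) < s := by exact_mod_cast hs1
  have hsN' : (s:ℝ) ≤ N := by exact_mod_cast hsN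
  obtain ⟨c, hc, hcs, hf⟩ := aux_cauchy p hp0 hps i
  set x : ℝ := ((N : ℝ) - s) / (N : ℝ) with hxdef
  have hx0 : 0 ≤ x := div_nonneg (by linarith) hN'.le
  have hx1 : x = 1 - s / N := by rw [hxdef]; field_simp
  have hsN0 : 0 < (s:ℝ) / N := by positivity
  have hd := aux_deriv c hc hcs x hx0 (by linarith) (fun x => μ x ^ i)
    (fun x hx => by simp only [hμ]; exact hf x hx)
  set d : ℕ → ℝ := fun l => ∑' k, c k * (k.choose l) * x ^ (k - l) with hddef
  have hd0 : ∀ l, 0 ≤ d l := fun l => tsum_nonneg fun k => by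
    have := hc k
    positivity
  -- taylor
  have htay : ∀ t : ℕ, t ≤ s → HasSum (fun l : ℕ => (t:ℝ) ^ l * (d l / (N:ℝ) ^ l))
      ((∑' j, p j * (((N - s + t : ℕ) : ℝ) / N) ^ j) ^ i) := by
    intro t ht
    have ht' : (t:ℝ) ≤ s := by exact_mod_cast ht
    have hle : (t:ℝ) / N ≤ s / N := by gcongr
    have e : ((N - s + t : ℕ) : ℝ) / N = x + t / N := by
      push_cast [Nat.cast_sub hsN]; rw [hxdef]; ring
    have ht0 : 0 ≤ (t:ℝ) / N := by positivity
    rw [e, hf _ (by rw [abs_of_nonneg (by positivity)]; linarith)]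
    have := aux_swap c hc hcs x (t / N) hx0 (by rw [abs_of_nonneg ht0]; linarith)
    convert this using 2 with l
    rw [div_pow]; ring
  -- combinatorial data
  let e : Fin s ↪ Fin N := (S.orderEmbOfFin hS).toEmbedding
  have heS : Finset.univ.map e = S := by
    simp [e]
  let H : (Fin i → List (Fin N)) → Finset (Fin s) := fun g =>
    Finset.univ.filter fun a => ∃ u, e a ∈ g u
  have hH : ∀ g, (S.filter (fun v => ∃ u, v ∈ g u)).card = (H g).card := by
    intro g
    rw [← Finset.card_map e]
    congr 1
    rw [← heS, Finset.filter_map]; rfl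
  let W := transWeight N i p
  have hW0 : ∀ g, 0 ≤ W g := fun g => Finset.prod_nonneg fun u _ =>
    mul_nonneg (hp0 _) (by positivity)
  have hA : ∀ T : Finset (Fin s), HasSum (fun g => if H g ⊆ T then W g else 0)
      ((∑' j, p j * (((N - s + T.card : ℕ) : ℝ) / N) ^ j) ^ i) := by
    intro T
    have h1 := aux_list N hN p hp0 hps ((Tᶜ).map e)ᶜ
    have hcard : (((Tᶜ).map e)ᶜ).card = N - s + T.card := by
      have : T.card ≤ s := by simpa using Finset.card_le_univ T
      rw [Finset.card_compl, Finset.card_map, Finset.card_compl, Fintype.card_fin,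
        Fintype.card_fin]; omega
    rw [hcard] at h1
    have h2 := aux_prod _ (fun l => by
      have := hp0 l.length
      split_ifs <;> positivity) h1.summable i
    rw [h1.tsum_eq] at h2
    convert h2 using 2 with g
    rw [Finset.prod_ite_zero]
    have : (∀ u ∈ Finset.univ, ∀ v ∈ g u, v ∈ ((Tᶜ).map e)ᶜ) ↔ H g ⊆ T := by
      simp only [H, Finset.subset_iff, Finset.mem_filter, Finset.mem_univ, true_and,
        Finset.mem_compl, Finset.mem_map, forall_true_left, not_exists, not_and]
      constructor
      · rintro h a ⟨u, hu⟩
        by_contra hcon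
        exact h u _ hu a hcon rfl
      · rintro h u v hv a ha rfl
        exact ha (h ⟨u, hv⟩)
    simp only [this]; rfl
  have hWs : Summable W := by
    have := (hA Finset.univ).summable
    simpa using this
  have hAs : ∀ (P : (Fin i → List (Fin N)) → Prop) [DecidablePred P], Summable fun g => if P g then W g else 0 := by
    intro P _
    refine Summable.of_nonneg_of_le (fun g => ?_) (fun g => ?_) hWs
    · split_ifs; exacts [hW0 g, le_rfl]
    · split_ifs; exacts [le_rfl, hW0 g]
  let a : ℕ → ℝ := fun l => d l / (N:ℝ) ^ l
  have ha0 : ∀ l, 0 ≤ a l := fun l => div_nonneg (hd0 l) (by positivity)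
  let C : (l : ℕ) → Finset (Fin s) → ℝ := fun l T =>
    ((Finset.univ.filter fun f : Fin l → Fin s => Finset.univ.image f = T).card : ℝ)
  have hBs : ∀ T, Summable fun l => C l T * a l := by
    intro T
    refine Summable.of_nonneg_of_le (fun l => mul_nonneg (Nat.cast_nonneg _) (ha0 l))
      (fun l => ?_) (htay s le_rfl).summable
    refine mul_le_mul_of_nonneg_right ?_ (ha0 l)
    have := Finset.card_le_univ
      (Finset.univ.filter fun f : Fin l → Fin s => Finset.univ.image f = T)
    simp only [Fintype.card_fun, Fintype.card_fin] at this
    simp only [C]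
    exact_mod_cast this
  have hAB : ∀ T : Finset (Fin s),
      (∑' g, if H g = T then W g else 0) = ∑' l, C l T * a l := by
    refine aux_mobius _ _ fun T => ?_
    rw [← Summable.tsum_finsetSum fun U _ => hAs _, ← Summable.tsum_finsetSum fun U _ => hBs _]
    have h1 : ∀ g, (∑ U ∈ T.powerset, if H g = U then W g else 0) =
        if H g ⊆ T then W g else 0 := by
      intro g
      rw [Finset.sum_ite_eq]; simp
    have h2 : ∀ l, (∑ U ∈ T.powerset, C l U * a l) = (T.card : ℝ) ^ l * a l := by
      intro l
      rw [← Finset.sum_mul]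
      congr 1
      simp only [C]
      rw [← Nat.cast_sum, ← Finset.card_biUnion]
      · have : (T.powerset.biUnion fun U => Finset.univ.filter fun f : Fin l → Fin s =>
            Finset.univ.image f = U) = Fintype.piFinset fun _ => T := by
          ext f
          simp [Finset.subset_iff]
        rw [this, Fintype.card_piFinset]; simp
      · intro U _ V _ hUV
        rw [Function.onFun, Finset.disjoint_left]
        intro f hf hf'
        simp only [Finset.mem_filter, Finset.mem_univ, true_and] at hf hf'
        exact hUV (hf.symm.trans hf')
    simp only [h1, h2]
    rw [(hA T).tsum_eq, (htay T.card (by simpa using Finset.card_le_univ T)).tsum_eq]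
  -- conclusion
  have hL : transProb N i p {g | (S.filter (fun v => ∃ u, v ∈ g u)).card = m} =
      ∑ T ∈ Finset.powersetCard m (Finset.univ : Finset (Fin s)),
        ∑' g, if H g = T then W g else 0 := by
    rw [← Summable.tsum_finsetSum fun U _ => hAs _]
    refine tsum_congr fun g => ?_
    have hiff : g ∈ {g : Fin i → List (Fin N) | (S.filter (fun v => ∃ u, v ∈ g u)).card = m} ↔
        H g ∈ Finset.powersetCard m (Finset.univ : Finset (Fin s)) := by
      simp only [Finset.mem_powersetCard, Finset.subset_univ, true_and, ← hH]
      exact Iff.rfl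
    rw [Finset.sum_ite_eq, Set.indicator_apply]
    exact if_congr hiff rfl rfl
  rw [hL, Finset.sum_congr rfl fun T _ => hAB T, ← Summable.tsum_finsetSum fun U _ => hBs _]
  refine tsum_congr fun l => ?_
  rw [← Finset.sum_mul]
  have hC : ∑ T ∈ Finset.powersetCard m (Finset.univ : Finset (Fin s)), C l T =
      distinctProb s l m * (s:ℝ) ^ l := by
    rw [distinctProb, div_mul_cancel₀ _ (by positivity)]
    simp only [C]
    rw [← Nat.cast_sum, ← Finset.card_biUnion]
    · congr 2
      ext f
      simp
    · intro U _ V _ hUV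
      rw [Function.onFun, Finset.disjoint_left]
      intro f hf hf'
      simp only [Finset.mem_filter, Finset.mem_univ, true_and] at hf hf'
      exact hUV (hf.symm.trans hf')
  rw [hC]
  split_ifs with hml
  · rw [mul_assoc _ (1 / (l.factorial : ℝ)), hd l]
    simp only [a]
    rw [div_pow]; ring
  · have : distinctProb s l m = 0 := by
      rw [distinctProb, Finset.filter_eq_empty_iff.2]
      · simp
      · intro f _ hfm
        have := Finset.card_image_le (s := (Finset.univ : Finset (Fin l))) (f := f)
        simp at this
        omega
    rw [this]; simp
end
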